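/- Let G be a connected graph on n vertices with finite girth g that is not a cycle. Then the number of Laplacian eigenvalues of G in the interval (n−g+3, n] is at most n−g. Equivalently, μ_{n−g+1}(G) ≤ n−g+3, where eigenvalues are listed in non-increasing order μ₁ ≥ ⋯ ≥ μ_n. -/

import Mathlib

open scoped Classical

/-- The multiset of Laplacian eigenvalues of a finite simple graph, with multiplicity
(the Laplacian matrix `L = D - A` is real symmetric, hence Hermitian). -/

noncomputable def lapEigs {V : Type*} [Fintype V] (G : SimpleGraph V) : Multiset ℝ :=
  Finset.univ.val.map (SimpleGraph.posSemidef_lapMatrix ℝ G).1.eigenvalues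

/-- Laplacian eigenvalues sorted in non-decreasing order. -/

noncomputable def lapEigsAsc {V : Type*} [Fintype V] (G : SimpleGraph V) : List ℝ :=
  (lapEigs G).sort (· ≤ ·)

/-- `lapMu G k` is the `k`-th largest Laplacian eigenvalue of `G` (1-indexed),
so `lapMu G 1 ≥ lapMu G 2 ≥ ⋯ ≥ lapMu G n`. -/
noncomputable def lapMu {V : Type*} [Fintype V] (G : SimpleGraph V) (k : ℕ) : ℝ :=
  (lapEigsAsc G).getD (Fintype.card V - k) 0

/-- `lapCount G I` is the number of Laplacian eigenvalues of `G` (with multiplicity)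
lying in the set `I ⊆ ℝ`. -/

noncomputable def lapCount {V : Type*} [Fintype V] (G : SimpleGraph V) (I : Set ℝ) : ℕ :=
  ((lapEigs G).filter (· ∈ I)).card

section GirthHelpers

open SimpleGraph Matrix Fin.NatCast Fin.CommRing

lemma girthAux_walk_close {V : Type*} {G : SimpleGraph V} {g : ℕ} (hg : (g : ℕ∞) ≤ G.egirth)
    {a b : V} (h : G.Adj a b) (p : G.Walk b a) (hp : s(a, b) ∉ p.edges) : g ≤ p.length + 1 := by
  have hc : (Walk.cons h p.bypass).IsCycle := by
    rw [Walk.cons_isCycle_iff]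
    exact ⟨p.bypass_isPath, fun hh => hp (p.edges_bypass_subset_edges hh)⟩
  have h1 := hg.trans (egirth_le_length hc)
  have h2 : g ≤ (Walk.cons h p.bypass).length := by exact_mod_cast h1
  have h3 := p.length_bypass_le_length
  simp only [Walk.length_cons] at h2
  omega

lemma girthAux_walk {V : Type*} {G : SimpleGraph V} {m : ℕ} (c : Fin (m + 4) → V)
    (hadj : ∀ i, G.Adj (c i) (c (i + 1))) (i : Fin (m + 4)) (l : ℕ) :
    ∃ p : G.Walk (c i) (c (i + (l : Fin (m + 4)))), p.length = l ∧
      ∀ e ∈ p.edges, ∃ t < l, e = s(c (i + (t : Fin (m + 4))), c (i + ((t + 1 : ℕ) : Fin (m + 4)))) := by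
  induction l with
  | zero =>
    refine ⟨Walk.nil.copy rfl (by simp), by simp, by simp⟩
  | succ l ih =>
    obtain ⟨p, hp, he⟩ := ih
    have hh : G.Adj (c (i + (l : Fin (m + 4)))) (c (i + ((l + 1 : ℕ) : Fin (m + 4)))) := by
      have := hadj (i + (l : Fin (m + 4)))
      rwa [add_assoc, ← Nat.cast_succ] at this
    refine ⟨p.concat hh, by simp [hp], ?_⟩
    intro e hee
    rw [Walk.edges_concat, List.concat_eq_append, List.mem_append] at hee
    rcases hee with hee | hee
    · obtain ⟨t, ht, h⟩ := he e hee
      exact ⟨t, by omega, h⟩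
    · exact ⟨l, by omega, by simpa using hee⟩

lemma girthAux_cast {m s t : ℕ} (hs : s < m + 4) (ht : t < m + 4)
    (h : (s : Fin (m + 4)) = (t : Fin (m + 4))) : s = t := by
  have := congrArg Fin.val h
  rwa [Fin.val_natCast, Fin.val_natCast, Nat.mod_eq_of_lt hs, Nat.mod_eq_of_lt ht] at this

lemma girthAux_chord {V : Type*} {G : SimpleGraph V} {m : ℕ} (c : Fin (m + 4) → V)
    (hg : ((m + 4 : ℕ) : ℕ∞) ≤ G.egirth) (hinj : Function.Injective c)
    (hadj : ∀ i, G.Adj (c i) (c (i + 1))) (i j : Fin (m + 4)) (hij : G.Adj (c i) (c j)) :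
    j = i + 1 ∨ i = j + 1 := by
  obtain ⟨l, hl, rfl⟩ : ∃ l : ℕ, l < m + 4 ∧ j = i + (l : Fin (m + 4)) :=
    ⟨(j - i).val, (j - i).isLt, by simp⟩
  have hl0 : l ≠ 0 := by
    rintro rfl
    simp at hij
  by_cases hl1 : l = 1
  · left; simp [hl1]
  right
  obtain ⟨p, hp, he⟩ := girthAux_walk c hadj i l
  have := girthAux_walk_close hg hij.symm p (by
    intro hh
    obtain ⟨t, ht, h⟩ := he _ hh
    rw [Sym2.eq_iff] at h
    rcases h with ⟨h1, h2⟩ | ⟨h1, h2⟩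
    · have := girthAux_cast hl (by omega) (add_left_cancel (hinj h1))
      omega
    · have := girthAux_cast hl (by omega) (add_left_cancel (hinj h1))
      have h3 : i + ((0 : ℕ) : Fin (m + 4)) = i + (t : Fin (m + 4)) := by simpa using hinj h2
      have := girthAux_cast (by omega) (by omega) (add_left_cancel h3)
      omega)
  have hl3 : l + 1 = m + 4 := by omega
  rw [add_assoc]
  have : ((l : Fin (m + 4)) + 1) = 0 := by
    have h5 : ((l + 1 : ℕ) : Fin (m + 4)) = 0 := by rw [hl3]; simp
    simpa using h5
  rw [this, add_zero]

lemma girthAux_outside_aux {V : Type*} {G : SimpleGraph V} {m : ℕ} (c : Fin (m + 4) → V)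
    (hg : ((m + 4 : ℕ) : ℕ∞) ≤ G.egirth) 
    (hadj : ∀ i, G.Adj (c i) (c (i + 1))) (w : V) (hw : ∀ i, c i ≠ w) (i : Fin (m + 4)) (l : ℕ)
    (hne : c i ≠ c (i + (l : Fin (m + 4))))
    (hi : G.Adj w (c i)) (hj : G.Adj w (c (i + (l : Fin (m + 4))))) :
    m + 4 ≤ l + 2 := by
  obtain ⟨p, hp, he⟩ := girthAux_walk c hadj i l
  have := girthAux_walk_close hg hi (p.concat hj.symm) (by
    intro hh
    rw [Walk.edges_concat, List.concat_eq_append, List.mem_append] at hh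
    rcases hh with hh | hh
    · obtain ⟨t, ht, h⟩ := he _ hh
      rw [Sym2.eq_iff] at h
      rcases h with ⟨h1, h2⟩ | ⟨h1, h2⟩
      · exact hw _ h1.symm
      · exact hw _ h1.symm
    · rw [List.mem_singleton, Sym2.eq_iff] at hh
      rcases hh with ⟨h1, h2⟩ | ⟨h1, h2⟩
      · exact hw _ h1.symm
      · exact hne h2)
  rw [Walk.length_concat, hp] at this
  omega

lemma girthAux_outside {V : Type*} {G : SimpleGraph V} {m : ℕ} (c : Fin (m + 4) → V)
    (hg : ((m + 4 : ℕ) : ℕ∞) ≤ G.egirth) (hinj : Function.Injective c)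
    (hadj : ∀ i, G.Adj (c i) (c (i + 1))) (w : V) (hw : ∀ i, c i ≠ w) (i j : Fin (m + 4))
    (hne : i ≠ j) (hi : G.Adj w (c i)) (hj : G.Adj w (c j)) :
    m = 0 ∧ j = i + 2 := by
  have key : ∀ i j : Fin (m + 4), i ≠ j → G.Adj w (c i) → G.Adj w (c j) →
      m + 4 ≤ (j - i).val + 2 := by
    intro i j hne hi hj
    have e : i + (((j - i).val : ℕ) : Fin (m + 4)) = j := by simp
    exact girthAux_outside_aux c hg hadj w hw i (j - i).val
      (by rw [e]; exact fun h => hne (hinj h)) hi (by rw [e]; exact hj)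
  have h1 := key i j hne hi hj
  have h2 := key j i hne.symm hj hi
  have hm : m = 0 := by
    rw [Fin.val_sub] at h1 h2
    have := i.isLt
    have := j.isLt
    have hne' : i.val ≠ j.val := fun h => hne (Fin.ext h)
    rcases Nat.lt_or_ge i.val j.val with h | h
    · rw [show m + 4 - j.val + i.val = m + 4 - (j.val - i.val) by omega,
        Nat.mod_eq_of_lt (by omega)] at h2
      rw [show m + 4 - i.val + j.val = (j.val - i.val) + (m + 4) by omega, Nat.add_mod_right,
        Nat.mod_eq_of_lt (by omega)] at h1
      omega
    · rw [show m + 4 - i.val + j.val = m + 4 - (i.val - j.val) by omega,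
        Nat.mod_eq_of_lt (by omega)] at h1
      rw [show m + 4 - j.val + i.val = (i.val - j.val) + (m + 4) by omega, Nat.add_mod_right,
        Nat.mod_eq_of_lt (by omega)] at h2
      omega
  refine ⟨hm, ?_⟩
  subst hm
  clear * - h1 h2 hne
  revert i j
  decide

lemma girthAux_count {V ι : Type*} [Fintype V] [Fintype ι] (G : SimpleGraph V) (c d : ℝ)
    (f : ι → ((V → ℝ) →ₗ[ℝ] ℝ))
    (hf : ∀ x : V → ℝ, (∀ u, f u x = 0) →
      (∑ i : V, ∑ j : V, if G.Adj i j then (x i - x j) ^ 2 else 0) / 2 ≤ c * ∑ i, x i ^ 2) :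
    lapCount G (Set.Ioc c d) ≤ Fintype.card ι := by
  set hA := (SimpleGraph.posSemidef_lapMatrix ℝ G).1 with hAdef
  have h1 : lapCount G (Set.Ioc c d) ≤ Fintype.card {i // c < hA.eigenvalues i} := by
    unfold lapCount lapEigs
    rw [Multiset.filter_map, Multiset.card_map, Fintype.card_subtype]
    rw [← Finset.filter_val, ← Finset.card_def]
    apply Finset.card_le_card
    intro i hi
    simp only [Finset.mem_filter, Finset.mem_univ, true_and, Function.comp_apply] at hi ⊢
    exact hi.1
  refine h1.trans ?_
  by_contra hlt
  push Not at hlt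
  let v : V → V → ℝ := fun i => ⇑(hA.eigenvectorBasis i)
  have hv : ∀ i j, v i ⬝ᵥ v j = if i = j then 1 else 0 := by
    intro i j
    have := orthonormal_iff_ite.mp hA.eigenvectorBasis.orthonormal j i
    rw [EuclideanSpace.inner_eq_star_dotProduct] at this
    simp only [star_trivial] at this
    simp only [eq_comm (a := i)]
    exact this
  have hL : ∀ i, G.lapMatrix ℝ *ᵥ v i = hA.eigenvalues i • v i := fun i =>
    hA.mulVec_eigenvectorBasis i
  let S : ({i // c < hA.eigenvalues i} → ℝ) →ₗ[ℝ] (V → ℝ) :=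
    Fintype.linearCombination ℝ (fun i : {i // c < hA.eigenvalues i} => v i)
  have hker : LinearMap.ker ((LinearMap.pi f).comp S) ≠ ⊥ := by
    apply LinearMap.ker_ne_bot_of_finrank_lt
    simpa using hlt
  obtain ⟨a, ha, ha0⟩ := (Submodule.ne_bot_iff _).mp hker
  have hx := hf (S a) (fun u => congrFun (LinearMap.mem_ker.mp ha) u)
  rw [← SimpleGraph.lapMatrix_toLinearMap₂' (R := ℝ) G, Matrix.toLinearMap₂'_apply'] at hx
  have hS : S a = ∑ i, a i • v i := by simp [S, Fintype.linearCombination_apply]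
  have e1 : ∑ i, (S a) i ^ 2 = ∑ i, a i ^ 2 := by
    have : ∑ i, (S a) i ^ 2 = S a ⬝ᵥ S a := by simp [dotProduct, sq]
    rw [this, hS]
    simp only [sum_dotProduct, dotProduct_sum, smul_dotProduct, dotProduct_smul, hv, smul_eq_mul,
      Subtype.coe_inj]
    simp [sq]
  have e2 : S a ⬝ᵥ (G.lapMatrix ℝ *ᵥ S a) =
      ∑ i : {i // c < hA.eigenvalues i}, hA.eigenvalues i * a i ^ 2 := by
    rw [hS]
    simp only [Matrix.mulVec_sum, Matrix.mulVec_smul, hL, sum_dotProduct, dotProduct_sum,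
      smul_dotProduct, dotProduct_smul, hv, smul_eq_mul, Subtype.coe_inj]
    simp only [mul_ite, mul_one, mul_zero, Finset.sum_ite_eq', Finset.mem_univ, if_true]
    exact Finset.sum_congr rfl fun i _ => by ring
  have hlt2 : c * ∑ i, a i ^ 2 < ∑ i : {i // c < hA.eigenvalues i}, hA.eigenvalues i * a i ^ 2 := by
    rw [Finset.mul_sum]
    obtain ⟨k, hk⟩ := Function.ne_iff.mp ha0
    apply Finset.sum_lt_sum
    · intro i _
      exact mul_le_mul_of_nonneg_right i.2.le (sq_nonneg _)
    · exact ⟨k, Finset.mem_univ _, mul_lt_mul_of_pos_right k.2 (by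
        have : a k ≠ 0 := hk
        positivity)⟩
  rw [e1] at hx
  have := e2 ▸ hx
  linarith

lemma girthAux_form {V : Type*} [Fintype V] (G : SimpleGraph V) {m : ℕ} (c : Fin (m + 4) → V)
    (hg : ((m + 4 : ℕ) : ℕ∞) ≤ G.egirth) (hinj : Function.Injective c)
    (hadj : ∀ i, G.Adj (c i) (c (i + 1))) (w : V) (hw : ∀ i, c i ≠ w) (x : V → ℝ)
    (hx : ∀ u, u ≠ w → (∀ i, c i ≠ u) → x u = 0)
    (hcore : ∑ p, (x (c p) - x (c (p + 1))) ^ 2 +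
        ∑ p, (if G.Adj w (c p) then (x w - x (c p)) ^ 2 else 0) ≤
        4 * (x w ^ 2 + ∑ p, x (c p) ^ 2)) :
    (∑ i : V, ∑ j : V, if G.Adj i j then (x i - x j) ^ 2 else 0) / 2 ≤
      ((Fintype.card V : ℝ) - ((m + 4 : ℕ) : ℝ) + 3) * ∑ i, x i ^ 2 := by
  set q : V → V → ℝ := fun i j => if G.Adj i j then (x i - x j) ^ 2 else 0 with hq
  have hqs : ∀ i j, q i j = q j i := by
    intro i j
    simp only [hq, G.adj_comm i j]
    split_ifs
    · ring
    · rfl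
  set S : Finset V := Finset.univ.image c with hS
  have hwS : w ∉ S := by simpa [hS] using hw
  set H : Finset V := insert w S with hH
  have hxH : ∀ u ∈ Hᶜ, x u = 0 := by
    intro u hu
    simp only [hH, hS, Finset.mem_compl, Finset.mem_insert, Finset.mem_image, Finset.mem_univ,
      true_and, not_or, not_exists] at hu
    exact hx u hu.1 hu.2
  have hcS : S.card = m + 4 := by
    rw [hS, Finset.card_image_of_injective _ hinj]; simp
  have hcH : ((Hᶜ).card : ℝ) = (Fintype.card V : ℝ) - ((m + 4 : ℕ) : ℝ) - 1 := by
    have h1 := Finset.card_add_card_compl H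
    rw [hH, Finset.card_insert_of_notMem hwS, hcS, ← hH] at h1
    have : ((m + 4 : ℕ) : ℝ) + 1 + ((Hᶜ).card : ℝ) = (Fintype.card V : ℝ) := by
      exact_mod_cast h1
    linarith
  have hsq : ∑ i, x i ^ 2 = x w ^ 2 + ∑ p, x (c p) ^ 2 := by
    rw [← Finset.sum_add_sum_compl H, Finset.sum_eq_zero (s := Hᶜ)
      (fun u hu => by rw [hxH u hu]; ring), hH, Finset.sum_insert hwS, hS,
      Finset.sum_image (fun a _ b _ h => hinj h)]
    ring
  have hsqH : ∑ i, x i ^ 2 = ∑ i ∈ H, x i ^ 2 := by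
    rw [← Finset.sum_add_sum_compl H, Finset.sum_eq_zero (s := Hᶜ)
      (fun u hu => by rw [hxH u hu]; ring), add_zero]
  have hsplit : ∑ i, ∑ j, q i j =
      ∑ i ∈ H, ∑ j ∈ H, q i j + 2 * ∑ i ∈ H, ∑ j ∈ Hᶜ, q i j := by
    rw [← Finset.sum_add_sum_compl H]
    have e1 : ∀ i, ∑ j, q i j = ∑ j ∈ H, q i j + ∑ j ∈ Hᶜ, q i j :=
      fun i => (Finset.sum_add_sum_compl H _).symm
    simp only [e1, Finset.sum_add_distrib]
    have e2 : ∑ i ∈ Hᶜ, ∑ j ∈ H, q i j = ∑ i ∈ H, ∑ j ∈ Hᶜ, q i j := by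
      rw [Finset.sum_comm]
      exact Finset.sum_congr rfl fun i _ => Finset.sum_congr rfl fun j _ => hqs _ _
    have e3 : ∑ i ∈ Hᶜ, ∑ j ∈ Hᶜ, q i j = 0 := by
      refine Finset.sum_eq_zero fun i hi => Finset.sum_eq_zero fun j hj => ?_
      simp [hq, hxH i hi, hxH j hj]
    rw [e2, e3]
    ring
  have hcross : ∑ i ∈ H, ∑ j ∈ Hᶜ, q i j ≤ ((Hᶜ).card : ℝ) * ∑ i ∈ H, x i ^ 2 := by
    rw [Finset.mul_sum]
    refine Finset.sum_le_sum fun i _ => ?_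
    rw [← nsmul_eq_mul]
    refine Finset.sum_le_card_nsmul _ _ _ fun j hj => ?_
    simp only [hq, hxH j hj, sub_zero]
    split_ifs
    · exact le_rfl
    · positivity
  have hHH : ∑ i ∈ H, ∑ j ∈ H, q i j = ∑ p, ∑ r, q (c p) (c r) + 2 * ∑ p, q w (c p) := by
    have e0 : ∀ f : V → ℝ, ∑ j ∈ H, f j = f w + ∑ p, f (c p) := by
      intro f
      rw [hH, Finset.sum_insert hwS, hS, Finset.sum_image (fun a _ b _ h => hinj h)]
    simp only [e0, Finset.sum_add_distrib]
    have e1 : q w w = 0 := by simp [hq]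
    simp only [fun p => hqs (c p) w]
    rw [e1]
    ring
  have hcyc : ∑ p, ∑ r, q (c p) (c r) ≤ 2 * ∑ p, (x (c p) - x (c (p + 1))) ^ 2 := by
    have hb : ∀ p r, q (c p) (c r) ≤ (if r = p + 1 then (x (c p) - x (c (p + 1))) ^ 2 else 0) +
        (if p = r + 1 then (x (c r) - x (c (r + 1))) ^ 2 else 0) := by
      intro p r
      have n1 : 0 ≤ (if r = p + 1 then (x (c p) - x (c (p + 1))) ^ 2 else 0) := by positivity
      have n2 : 0 ≤ (if p = r + 1 then (x (c r) - x (c (r + 1))) ^ 2 else 0) := by positivity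
      by_cases ha : G.Adj (c p) (c r)
      · have hqe : q (c p) (c r) = (x (c p) - x (c r)) ^ 2 := by simp [hq, ha]
        rcases girthAux_chord c hg hinj hadj p r ha with h | h
        · have : (if r = p + 1 then (x (c p) - x (c (p + 1))) ^ 2 else 0) = q (c p) (c r) := by
            rw [if_pos h, hqe, h]
          linarith
        · have : (if p = r + 1 then (x (c r) - x (c (r + 1))) ^ 2 else 0) = q (c p) (c r) := by
            rw [if_pos h, hqe, h]; ring
          linarith
      · have hqe : q (c p) (c r) = 0 := by simp [hq, ha]
        linarith
    calc ∑ p, ∑ r, q (c p) (c r) ≤ ∑ p, ∑ r,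
          ((if r = p + 1 then (x (c p) - x (c (p + 1))) ^ 2 else 0) +
          (if p = r + 1 then (x (c r) - x (c (r + 1))) ^ 2 else 0)) :=
          Finset.sum_le_sum fun p _ => Finset.sum_le_sum fun r _ => hb p r
      _ = 2 * ∑ p, (x (c p) - x (c (p + 1))) ^ 2 := by
          simp only [Finset.sum_add_distrib]
          rw [Finset.sum_comm (f := fun p r =>
            if p = r + 1 then (x (c r) - x (c (r + 1))) ^ 2 else 0)]
          simp only [Finset.sum_ite_eq', Finset.mem_univ, if_true]
          ring
  change (∑ i, ∑ j, q i j) / 2 ≤ _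
  change _ + ∑ p, q w (c p) ≤ _ at hcore
  rw [← hsq] at hcore
  rw [← hsqH, hcH] at hcross
  rw [hsplit, hHH]
  nlinarith

lemma girthAux_cycle_le {m : ℕ} (y : Fin (m + 4) → ℝ) :
    ∑ p, (y p - y (p + 1)) ^ 2 ≤ 4 * ∑ p, y p ^ 2 := by
  have h1 : ∑ p, y (p + 1) ^ 2 = ∑ p, y p ^ 2 :=
    Equiv.sum_comp (Equiv.addRight (1 : Fin (m + 4))) (fun p => y p ^ 2)
  calc ∑ p, (y p - y (p + 1)) ^ 2 ≤ ∑ p, (2 * y p ^ 2 + 2 * y (p + 1) ^ 2) :=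
        Finset.sum_le_sum fun p _ => by nlinarith [sq_nonneg (y p + y (p + 1))]
    _ = 4 * ∑ p, y p ^ 2 := by
        rw [Finset.sum_add_distrib, ← Finset.mul_sum, ← Finset.mul_sum, h1]; ring

/-- The functional attached to the distinguished outside vertex. -/
lemma girthAux_functional {V : Type*} [Fintype V] (G : SimpleGraph V) {m : ℕ}
    (c : Fin (m + 4) → V)
    (hg : ((m + 4 : ℕ) : ℕ∞) ≤ G.egirth) (hinj : Function.Injective c)
    (hadj : ∀ i, G.Adj (c i) (c (i + 1))) (w : V) (hw : ∀ i, c i ≠ w) (v : Fin (m + 4))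
    (hv : G.Adj w (c v)) :
    ∃ f : (V → ℝ) →ₗ[ℝ] ℝ, ∀ x, f x = 0 → ∑ p, (x (c p) - x (c (p + 1))) ^ 2 +
        ∑ p, (if G.Adj w (c p) then (x w - x (c p)) ^ 2 else 0) ≤
        4 * (x w ^ 2 + ∑ p, x (c p) ^ 2) := by
  by_cases h : ∃ r, v ≠ r ∧ G.Adj w (c r)
  · obtain ⟨r, hne, hr⟩ := h
    obtain ⟨hm, hr2⟩ := girthAux_outside c hg hinj hadj w hw v r hne hv hr
    subst hm
    refine ⟨LinearMap.proj (R := ℝ) (φ := fun _ : V => ℝ) (c v) +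
      LinearMap.proj (R := ℝ) (φ := fun _ : V => ℝ) (c r), fun x hx => ?_⟩
    have hx' : x (c v) + x (c r) = 0 := by simpa using hx
    have hsum : ∀ f : Fin (0 + 4) → ℝ, ∑ p, f p = f v + f (v + 1) + f (v + 2) + f (v + 3) := by
      intro f
      rw [← Equiv.sum_comp (Equiv.addLeft v) f, Fin.sum_univ_four]
      simp
    have n1 : ¬ G.Adj w (c (v + 1)) := by
      intro hh
      have := (girthAux_outside c hg hinj hadj w hw v _ (by clear * -; revert v; decide) hv hh).2
      revert this; clear * -; revert v; decide
    have n3 : ¬ G.Adj w (c (v + 3)) := by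
      intro hh
      have := (girthAux_outside c hg hinj hadj w hw v _ (by clear * -; revert v; decide) hv hh).2
      revert this; clear * -; revert v; decide
    have e2 : v + 1 + 1 = v + 2 := by clear * -; revert v; decide
    have e3 : v + 2 + 1 = v + 3 := by clear * -; revert v; decide
    have e4 : v + 3 + 1 = v := by clear * -; revert v; decide
    subst hr2
    rw [hsum, hsum, hsum, e2, e3, e4, if_pos hv, if_pos hr, if_neg n1, if_neg n3]
    have : x (c (v + 2)) = - x (c v) := by linarith
    rw [this]
    nlinarith [sq_nonneg (x (c v)), sq_nonneg (x (c (v + 1))), sq_nonneg (x (c (v + 3))),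
      sq_nonneg (x w)]
  · push Not at h
    refine ⟨LinearMap.proj (R := ℝ) (φ := fun _ : V => ℝ) w -
      LinearMap.proj (R := ℝ) (φ := fun _ : V => ℝ) (c v), fun x hx => ?_⟩
    have hx' : x w - x (c v) = 0 := by simpa using hx
    have h0 : ∑ p, (if G.Adj w (c p) then (x w - x (c p)) ^ 2 else 0) = 0 := by
      refine Finset.sum_eq_zero fun p _ => ?_
      by_cases hp : v = p
      · subst hp; simp [hx']
      · rw [if_neg (h p hp)]
    have := girthAux_cycle_le (fun p => x (c p))
    rw [h0]
    nlinarith [sq_nonneg (x w)]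

lemma girthAux_main {V : Type*} [Fintype V] (G : SimpleGraph V) {m : ℕ} (c : Fin (m + 4) → V)
    (hconn : G.Connected)
    (hg : ((m + 4 : ℕ) : ℕ∞) ≤ G.egirth) (hinj : Function.Injective c)
    (hadj : ∀ i, G.Adj (c i) (c (i + 1)))
    (hnotcycle : ∀ m : ℕ, IsEmpty (G ≃g SimpleGraph.cycleGraph m)) (d : ℝ) :
    lapCount G (Set.Ioc ((Fintype.card V : ℝ) - ((m + 4 : ℕ) : ℝ) + 3) d) ≤
      Fintype.card V - (m + 4) := by
  have hns : ¬ Function.Surjective c := by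
    intro hs
    refine (hnotcycle (m + 4)).false (RelIso.symm ⟨Equiv.ofBijective c ⟨hinj, hs⟩, ?_⟩)
    intro a b
    change G.Adj (c a) (c b) ↔ (cycleGraph (m + 2 + 2)).Adj a b
    rw [cycleGraph_adj]
    constructor
    · intro h
      rcases girthAux_chord c hg hinj hadj a b h with rfl | rfl
      · right; simp
      · left; simp
    · rintro (h | h)
      · have : a = b + 1 := by rw [← h]; simp
        rw [this]; exact (hadj b).symm
      · have : b = a + 1 := by rw [← h]; simp
        rw [this]; exact hadj a
  obtain ⟨z, hz⟩ : ∃ z, ∀ i, c i ≠ z := by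
    simpa [Function.Surjective] using hns
  obtain ⟨p⟩ := hconn.preconnected (c 0) z
  obtain ⟨e, -, he1, he2⟩ := p.exists_boundary_dart (Set.range c) ⟨0, rfl⟩ (by simpa using hz)
  obtain ⟨v, hv⟩ := he1
  have hw : ∀ i, c i ≠ e.snd := by simpa using he2
  have hwv : G.Adj e.snd (c v) := by rw [hv]; exact e.adj.symm
  generalize e.snd = w at hw hwv
  obtain ⟨f, hf⟩ := girthAux_functional G c hg hinj hadj w hw v hwv
  have hcard : Fintype.card {u : V // ∀ i, c i ≠ u} = Fintype.card V - (m + 4) := by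
    have h1 := Finset.card_compl (Finset.univ.image c)
    rw [Finset.card_image_of_injective _ hinj, Finset.card_univ, Fintype.card_fin] at h1
    rw [← h1, Fintype.card_subtype]
    congr 1
    ext u
    simp
  rw [← hcard]
  refine girthAux_count G _ d
    (fun u : {u : V // ∀ i, c i ≠ u} => if u.1 = w then f else LinearMap.proj u.1) ?_
  intro x hx
  refine girthAux_form G c hg hinj hadj w hw x ?_ (hf x ?_)
  · intro u hu hcu
    have := hx ⟨u, hcu⟩
    simpa [hu] using this
  · have := hx ⟨w, hw⟩
    simpa using this

end GirthHelpers

/-- If `G` is a connected non-cycle graph on `n` vertices with (finite) girth `g`,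
then `m_G(n−g+3, n] ≤ n−g`. -/
theorem lapCount_girth_upper_bound {n : ℕ} (G : SimpleGraph (Fin n)) (g : ℕ)
    (hconn : G.Connected) (hg : G.egirth = (g : ℕ∞))
    (hnotcycle : ∀ m : ℕ, IsEmpty (G ≃g SimpleGraph.cycleGraph m)) :
    lapCount G (Set.Ioc ((n : ℝ) - g + 3) (n : ℝ)) ≤ n - g := by
  have h3 : 3 ≤ g := by
    have := G.three_le_egirth
    rw [hg] at this
    exact_mod_cast this
  rcases Nat.lt_or_ge g 4 with hg4 | hg4
  · have : g = 3 := by omega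
    subst this
    have : Set.Ioc ((n : ℝ) - (3 : ℕ) + 3) (n : ℝ) = ∅ := by
      apply Set.Ioc_eq_empty
      push_cast
      intro h
      linarith
    rw [this]
    simp [lapCount]
  · obtain ⟨m, rfl⟩ : ∃ m, g = m + 4 := ⟨g - 4, by omega⟩
    have hac : ¬ G.IsAcyclic := by
      rw [← SimpleGraph.egirth_eq_top, hg]
      exact ENat.natCast_ne_top _
    obtain ⟨a, p, hp, hlen⟩ := SimpleGraph.exists_egirth_eq_length.mpr hac
    have hl : p.length = m + 4 := by
      rw [hg] at hlen
      exact_mod_cast hlen.symm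
    have hinj : Function.Injective (fun i : Fin (m + 4) => p.getVert i.val) := by
      intro i j hij
      exact Fin.ext (hp.getVert_injOn' (by simp; omega) (by simp; omega) hij)
    have hadj : ∀ i : Fin (m + 4), G.Adj (p.getVert i.val) (p.getVert (i + 1).val) := by
      intro i
      have h := p.adj_getVert_succ (i := i.val) (by omega)
      by_cases hi : i = Fin.last (m + 3)
      · subst hi
        have e : p.getVert (m + 3 + 1) = p.getVert 0 := by
          rw [show m + 3 + 1 = p.length by omega]; simp
        simpa [e] using h
      · rwa [Fin.val_add_one_of_lt (Fin.lt_last_iff_ne_last.mpr hi)]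
    have := girthAux_main G (fun i : Fin (m + 4) => p.getVert i.val) hconn hg.ge hinj hadj
      hnotcycle (n : ℝ)
    simpa only [Fintype.card_fin] using this
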